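/- For every a ∈ U, the function H_a(r) = ∫_{∂B(a,r)} ‖f‖² dℋ^{m−1} is differentiable at every r ∈ (0, dist(a, ℝ^m ∖ U)) with H_a′(r) = ((m−1)/r)·H_a(r) + 2∫_{∂B(a,r)} ⟨f, ∂f/∂ν⟩ dℋ^{m−1}. (No stationarity of f is assumed here.) -/

import Mathlib

open MeasureTheory Metric
open scoped RealInnerProductSpace ENNReal NNReal Topology
noncomputable section

/-- The separable Hilbert space `ℓ₂` of square-summable real sequences. -/
abbrev ell2 : Type := lp (fun _ : ℕ => ℝ) 2

/-- Euclidean space `ℝ^m`. -/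
abbrev Em (m : ℕ) : Type := EuclideanSpace ℝ (Fin m)

/-- Squared Hilbert–Schmidt norm `‖A‖²_HS = ∑ i ‖A eᵢ‖²` of `A : ℝ^m →L ℓ₂`. -/
def hsNormSq {m : ℕ} (A : Em m →L[ℝ] ell2) : ℝ :=
  ∑ i : Fin m, ‖A (EuclideanSpace.single i 1)‖ ^ 2

/-- Hilbert–Schmidt inner product `⟨A,B⟩ = ∑ i ⟨A eᵢ, B eᵢ⟩`. -/
def hsInner {m : ℕ} (A B : Em m →L[ℝ] ell2) : ℝ :=
  ∑ i : Fin m, ⟪A (EuclideanSpace.single i 1), B (EuclideanSpace.single i 1)⟫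

/-- Divergence `div X = ∑ i ⟨DX(x) eᵢ, eᵢ⟩` of a vector field `X : ℝ^m → ℝ^m`. -/
def divg {m : ℕ} (X : Em m → Em m) (x : Em m) : ℝ :=
  ∑ i : Fin m, ⟪fderiv ℝ X x (EuclideanSpace.single i 1), EuclideanSpace.single i 1⟫

/-- `f` is squeeze stationary on `U`: for every smooth compactly supported vector field
`X` with support in `U`, the inner variation `t ↦ ∫_U ‖D(f ∘ Φ_t)‖²_HS`,
`Φ_t(x) = x + tX(x)`, has derivative `0` at `t = 0`. -/
def SqueezeStationary {m : ℕ} (U : Set (Em m)) (f : Em m → ell2) : Prop :=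
  ∀ X : Em m → Em m, ContDiff ℝ (⊤ : ℕ∞) X → HasCompactSupport X → tsupport X ⊆ U →
    HasDerivAt
      (fun t : ℝ => ∫ x in U, hsNormSq (fderiv ℝ (fun y => f (y + t • X y)) x)) 0 0

/-- `f` is squash stationary on `U`: for every `C¹` map `Y : U × ℓ₂ → ℓ₂` which is
bounded, has bounded derivative, and with `{x : Y(x,·) ≢ 0}` relatively compact in `U`,
the outer variation `t ↦ ∫_U ‖D(f + tY(·, f(·)))‖²_HS` has derivative `0` at `t = 0`. -/
def SquashStationary {m : ℕ} (U : Set (Em m)) (f : Em m → ell2) : Prop :=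
  ∀ Y : Em m × ell2 → ell2, ContDiff ℝ 1 Y →
    (∃ C, ∀ p, ‖Y p‖ ≤ C) → (∃ C, ∀ p, ‖fderiv ℝ Y p‖ ≤ C) →
    IsCompact (closure {x : Em m | ∃ y, Y (x, y) ≠ 0}) →
    closure {x : Em m | ∃ y, Y (x, y) ≠ 0} ⊆ U →
    HasDerivAt
      (fun t : ℝ =>
        ∫ x in U, hsNormSq (fderiv ℝ (fun z => f z + t • Y (z, f z)) x)) 0 0
/-- Central projection of the faces `{z | z i = s}` of a cube onto the sphere of radius `1`
around `a`. -/
def cubeFaceToSphere {n : ℕ} (a : Em (n + 1)) (i : Fin (n + 1)) (s : ℝ) (y : Fin n → ℝ) :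
    Em (n + 1) :=
  a + ‖(WithLp.toLp 2 (i.insertNth s y) : Em (n + 1))‖⁻¹ • WithLp.toLp 2 (i.insertNth s y)

theorem contDiff_cubeFaceToSphere {n : ℕ} (a : Em (n + 1)) (i : Fin (n + 1)) {s : ℝ}
    (hs : s ≠ 0) : ContDiff ℝ 1 (cubeFaceToSphere a i s) := by
  have hw : ContDiff ℝ 1
      (fun y : Fin n → ℝ => (WithLp.toLp 2 (i.insertNth s y) : Em (n + 1))) := by
    rw [contDiff_euclidean]
    intro j
    rcases Fin.eq_self_or_eq_succAbove i j with rfl | ⟨k, rfl⟩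
    · simpa using contDiff_const
    · simpa using contDiff_apply ℝ ℝ k
  have hne : ∀ y : Fin n → ℝ, (WithLp.toLp 2 (i.insertNth s y) : Em (n + 1)) ≠ 0 := by
    intro y h
    have := congrArg (fun z : Em (n + 1) => z i) h
    simp [hs] at this
  exact contDiff_const.add
    (((hw.norm ℝ hne).inv fun y => norm_ne_zero_iff.2 (hne y)).smul hw)

theorem sphere_subset_iUnion_cubeFaceToSphere {n : ℕ} (a : Em (n + 1)) :
    sphere a 1 ⊆ ⋃ i : Fin (n + 1),
      (cubeFaceToSphere a i 1 '' closedBall 0 1 ∪ cubeFaceToSphere a i (-1) '' closedBall 0 1) := by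
  intro x hx
  set v : Em (n + 1) := x - a with hv
  have hv1 : ‖v‖ = 1 := by simpa [hv, dist_eq_norm] using hx
  obtain ⟨i, hi⟩ := Finite.exists_max (fun j => |v j|)
  have hi0 : v i ≠ 0 := by
    intro h0
    have : v = 0 := by
      ext j
      have := hi j
      simpa [h0] using this
    simp [this] at hv1
  have hpos : 0 < |v i| := abs_pos.2 hi0
  have hmem : (fun k => |v i|⁻¹ * v (i.succAbove k)) ∈ closedBall (0 : Fin n → ℝ) 1 := by
    rw [mem_closedBall_zero_iff, pi_norm_le_iff_of_nonneg zero_le_one]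
    intro k
    rw [norm_mul, norm_inv, Real.norm_eq_abs, abs_abs, Real.norm_eq_abs, inv_mul_le_iff₀ hpos,
      mul_one]
    exact hi _
  have key : ∀ s : ℝ, s = |v i|⁻¹ * v i →
      cubeFaceToSphere a i s (fun k => |v i|⁻¹ * v (i.succAbove k)) = x := by
    intro s hs
    have hw : (WithLp.toLp 2 (i.insertNth s fun k => |v i|⁻¹ * v (i.succAbove k)) : Em (n + 1))
        = |v i|⁻¹ • v := by
      ext j
      rcases Fin.eq_self_or_eq_succAbove i j with rfl | ⟨k, rfl⟩ <;> simp [hs]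
    rw [cubeFaceToSphere, hw, norm_smul, hv1, norm_inv, Real.norm_eq_abs, abs_abs, mul_one,
      inv_inv, smul_smul, mul_inv_cancel₀ hpos.ne', one_smul, hv, add_sub_cancel]
  refine Set.mem_iUnion.2 ⟨i, ?_⟩
  rcases lt_or_gt_of_ne hi0 with h | h
  · refine Or.inr ⟨_, hmem, key _ ?_⟩
    rw [abs_of_neg h]
    field_simp
  · refine Or.inl ⟨_, hmem, key _ ?_⟩
    rw [abs_of_pos h, inv_mul_cancel₀ hi0]

theorem hausdorffMeasure_sphere_lt_top {n : ℕ} (a : Em (n + 1)) :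
    μH[(n : ℝ)] (sphere a 1) < ∞ := by
  have hface : ∀ (i : Fin (n + 1)) {s : ℝ}, s ≠ 0 →
      μH[(n : ℝ)] (cubeFaceToSphere a i s '' closedBall 0 1) < ∞ := by
    intro i s hs
    obtain ⟨K, hK⟩ :=
      ((contDiff_cubeFaceToSphere a i hs).locallyLipschitz.locallyLipschitzOn
        (s := closedBall 0 1)).exists_lipschitzOnWith_of_compact (isCompact_closedBall 0 1)
    refine (hK.hausdorffMeasure_image_le n.cast_nonneg).trans_lt ?_
    refine ENNReal.mul_lt_top (ENNReal.rpow_lt_top_of_nonneg n.cast_nonneg ENNReal.coe_ne_top) ?_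
    have hvol : (μH[(n : ℝ)] : Measure (Fin n → ℝ)) = volume := by
      simpa using hausdorffMeasure_pi_real (ι := Fin n)
    rw [hvol]
    exact measure_closedBall_lt_top
  refine (measure_mono (sphere_subset_iUnion_cubeFaceToSphere a)).trans_lt ?_
  refine (measure_iUnion_le _).trans_lt ?_
  rw [tsum_fintype]
  exact ENNReal.sum_lt_top.2 fun i _ =>
    measure_union_lt_top (hface i one_ne_zero) (hface i (neg_ne_zero.2 one_ne_zero))

/-- Polar change of variables from the sphere of radius `ρ` to the sphere of radius `1`. -/
theorem setIntegral_sphere_hausdorffMeasure {E : Type*} [NormedAddCommGroup E]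
    [NormedSpace ℝ E] [MeasurableSpace E] [BorelSpace E] (n : ℕ) (a : E) {ρ : ℝ} (hρ : 0 < ρ)
    (g : E → ℝ) :
    ∫ x in sphere a ρ, g x ∂μH[(n : ℝ)]
      = ρ ^ n * ∫ x in sphere a 1, g (a + ρ • (x - a)) ∂μH[(n : ℝ)] := by
  have hmap := map_homothety_hausdorffMeasure (n.cast_nonneg (α := ℝ)) a hρ.ne'
  have hemb : MeasurableEmbedding (AffineMap.homothety a ρ : E → E) := by
    let e := (Homeomorph.subRight a).trans
      ((Homeomorph.smulOfNeZero ρ hρ.ne').trans (Homeomorph.addRight a))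
    have he : (AffineMap.homothety a ρ : E → E) = e := rfl
    exact he ▸ e.measurableEmbedding
  have hpre : (AffineMap.homothety a ρ : E → E) ⁻¹' sphere a ρ = sphere a 1 := by
    ext x
    simp [AffineMap.homothety_apply, norm_smul, abs_of_pos hρ, hρ.ne']
  have h := hemb.setIntegral_map (μ := μH[(n : ℝ)]) g (sphere a ρ)
  rw [hmap, hpre, Measure.restrict_smul, integral_smul_nnreal_measure] at h
  simp only [AffineMap.homothety_apply, vsub_eq_sub, vadd_eq_add, add_comm _ a] at h
  rw [← h, NNReal.smul_def, smul_eq_mul, ← mul_assoc]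
  have hc : ρ ^ n * ((‖ρ‖₊⁻¹ ^ (n : ℝ) : ℝ≥0) : ℝ) = 1 := by
    rw [NNReal.rpow_natCast]
    push_cast
    rw [Real.norm_of_nonneg hρ.le, ← mul_pow, mul_inv_cancel₀ hρ.ne', one_pow]
  rw [hc, one_mul]

theorem closedBall_subset_of_lt_infDist_compl {E : Type*} [PseudoMetricSpace E] {U : Set E}
    {a : E} {R : ℝ} (hR : R < infDist a Uᶜ) : closedBall a R ⊆ U := by
  intro x hx
  by_contra hxU
  have := infDist_le_dist_of_mem (x := a) (Set.mem_compl hxU)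
  rw [mem_closedBall, dist_comm] at hx
  linarith

/-- Differentiation under the integral sign for the spherical mean of a `C¹` function. -/
theorem hasDerivAt_setIntegral_sphere_dilation {E F : Type*} [NormedAddCommGroup E]
    [NormedSpace ℝ E] [ProperSpace E] [MeasurableSpace E] [BorelSpace E]
    [NormedAddCommGroup F] [InnerProductSpace ℝ F]
    {U : Set E} {f : E → F} {f' : E → E →L[ℝ] F}
    (hf : ∀ x ∈ U, HasFDerivAt f (f' x) x) (hf'c : ContinuousOn f' U)
    {a : E} {μ : Measure E} (hμ : μ (sphere a 1) < ∞)
    {r R : ℝ} (hr : 0 < r) (hrR : r < R) (hRU : closedBall a R ⊆ U) :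
    HasDerivAt (fun ρ : ℝ => ∫ x in sphere a 1, ‖f (a + ρ • (x - a))‖ ^ 2 ∂μ)
      (∫ x in sphere a 1, 2 * ⟪f (a + r • (x - a)), f' (a + r • (x - a)) (x - a)⟫ ∂μ) r := by
  have hfc : ContinuousOn f U := fun x hx => (hf x hx).continuousAt.continuousWithinAt
  have hmem : ∀ ρ ∈ Set.Ioo 0 R, ∀ x ∈ sphere a 1, a + ρ • (x - a) ∈ closedBall a R := by
    intro ρ hρ x hx
    rw [mem_sphere, dist_eq_norm] at hx
    simpa [dist_eq_norm, norm_smul, hx, abs_of_pos hρ.1] using hρ.2.le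
  have hdil : ∀ ρ : ℝ, Continuous fun x : E => a + ρ • (x - a) := fun ρ => by fun_prop
  have hcomp : ∀ ρ ∈ Set.Ioo 0 R,
      ContinuousOn (fun x => f (a + ρ • (x - a))) (sphere a 1) := fun ρ hρ =>
    hfc.comp (hdil ρ).continuousOn fun x hx => hRU (hmem ρ hρ x hx)
  have hcomp' : ∀ ρ ∈ Set.Ioo 0 R,
      ContinuousOn (fun x => f' (a + ρ • (x - a))) (sphere a 1) := fun ρ hρ =>
    hf'c.comp (hdil ρ).continuousOn fun x hx => hRU (hmem ρ hρ x hx)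
  obtain ⟨C, hC⟩ := (isCompact_closedBall a R).exists_bound_of_continuousOn (hfc.mono hRU)
  obtain ⟨C', hC'⟩ := (isCompact_closedBall a R).exists_bound_of_continuousOn (hf'c.mono hRU)
  have hnhds : Set.Ioo 0 R ∈ 𝓝 r := Ioo_mem_nhds hr hrR
  have hms : MeasurableSet (sphere a (1 : ℝ)) := isClosed_sphere.measurableSet
  have : IsFiniteMeasure (μ.restrict (sphere a 1)) := ⟨by simpa using hμ⟩
  refine (hasDerivAt_integral_of_dominated_loc_of_deriv_le (bound := fun _ => 2 * (C * C'))
    (F' := fun ρ x => 2 * ⟪f (a + ρ • (x - a)), f' (a + ρ • (x - a)) (x - a)⟫)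
    hnhds ?_ ?_ ?_ ?_ (integrable_const _) ?_).2
  · filter_upwards [hnhds] with ρ hρ
    exact ((hcomp ρ hρ).norm.pow 2).aestronglyMeasurable hms
  · refine Integrable.of_bound (C := C ^ 2)
      (((hcomp r ⟨hr, hrR⟩).norm.pow 2).aestronglyMeasurable hms) ?_
    filter_upwards [ae_restrict_mem hms] with x hx
    rw [norm_pow, norm_norm]
    gcongr
    exact hC _ (hmem r ⟨hr, hrR⟩ x hx)
  · refine ContinuousOn.aestronglyMeasurable ?_ hms
    exact continuousOn_const.mul ((hcomp r ⟨hr, hrR⟩).inner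
      ((hcomp' r ⟨hr, hrR⟩).clm_apply (by fun_prop)))
  · filter_upwards [ae_restrict_mem hms] with x hx ρ hρ
    have hy := hmem ρ hρ x hx
    rw [mem_sphere, dist_eq_norm] at hx
    rw [norm_mul, Real.norm_two]
    gcongr
    refine (norm_inner_le_norm _ _).trans ?_
    gcongr
    · exact (norm_nonneg _).trans (hC _ hy)
    · exact hC _ hy
    · refine ((f' _).le_opNorm _).trans ?_
      rw [hx, mul_one]
      exact hC' _ hy
  · filter_upwards [ae_restrict_mem hms] with x hx ρ hρ
    have hline : HasDerivAt (fun t : ℝ => a + t • (x - a)) (x - a) ρ := by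
      simpa using ((hasDerivAt_id ρ).smul_const (x - a)).const_add a
    exact ((hf _ (hRU (hmem ρ hρ x hx))).comp_hasDerivAt ρ hline).norm_sq

/-- Differentiability of `H_a(r) = ∫_{∂B(a,r)} ‖f‖² dℋ^{m−1}` with
`H_a'(r) = ((m−1)/r)·H_a(r) + 2∫_{∂B(a,r)} ⟨f, ∂f/∂ν⟩ dℋ^{m−1}` (no stationarity
assumed). -/
theorem stmt10 (m : ℕ) (hm : 2 ≤ m) (U : Set (Em m)) (hU : IsOpen U)
    (f : Em m → ell2) (f' : Em m → (Em m →L[ℝ] ell2))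
    (hf : ∀ x ∈ U, HasFDerivAt f (f' x) x) (hf'c : ContinuousOn f' U)
    (hfin : IntegrableOn (fun x => hsNormSq (f' x)) U volume)
    (a : Em m) (ha : a ∈ U)
    (r : ℝ) (hr : 0 < r) (hrU : r < Metric.infDist a Uᶜ) :
    HasDerivAt
      (fun ρ : ℝ => ∫ x in Metric.sphere a ρ, ‖f x‖ ^ 2 ∂(μH[((m : ℝ) - 1)]))
      (((m : ℝ) - 1) / r *
          (∫ x in Metric.sphere a r, ‖f x‖ ^ 2 ∂(μH[((m : ℝ) - 1)]))
        + 2 * ∫ x in Metric.sphere a r, ⟪f x, f' x (‖x - a‖⁻¹ • (x - a))⟫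
            ∂(μH[((m : ℝ) - 1)])) r := by
  obtain ⟨n, rfl⟩ : ∃ n, m = n + 1 := ⟨m - 1, by omega⟩
  obtain ⟨R, hrR, hR⟩ := exists_between hrU
  have hd : ((n + 1 : ℕ) : ℝ) - 1 = n := by push_cast; ring
  simp only [hd]
  have hder := (hasDerivAt_pow n r).mul (hasDerivAt_setIntegral_sphere_dilation hf hf'c
    (hausdorffMeasure_sphere_lt_top a) hr hrR (closedBall_subset_of_lt_infDist_compl hR))
  refine (hder.congr_of_eventuallyEq ?_).congr_deriv ?_
  · filter_upwards [lt_mem_nhds hr] with ρ hρ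
    exact setIntegral_sphere_hausdorffMeasure n a hρ _
  rw [setIntegral_sphere_hausdorffMeasure n a hr, setIntegral_sphere_hausdorffMeasure n a hr,
    integral_const_mul]
  have hnormal : ∀ x ∈ sphere a (1 : ℝ),
      ⟪f (a + r • (x - a)), f' (a + r • (x - a))
        (‖a + r • (x - a) - a‖⁻¹ • (a + r • (x - a) - a))⟫
        = ⟪f (a + r • (x - a)), f' (a + r • (x - a)) (x - a)⟫ := by
    intro x hx
    rw [mem_sphere, dist_eq_norm] at hx
    rw [add_sub_cancel_left, norm_smul, hx, mul_one, Real.norm_of_nonneg hr.le, smul_smul,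
      inv_mul_cancel₀ hr.ne', one_smul]
  rw [setIntegral_congr_fun isClosed_sphere.measurableSet hnormal]
  have hpow : (n : ℝ) * r ^ (n - 1) = n / r * r ^ n := by
    rcases n with _ | k
    · simp
    · rw [pow_succ, Nat.add_sub_cancel]
      field_simp
  rw [hpow]
  ring
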